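/- arXiv:1402.4880 — 2 statements merged into one kernel-verified Lean document; each statement's English description precedes it below -/
import Mathlib

section
/- (Parity Theorem.) Let q ≥ 1 and let S be a finite set of triples (i,j,(c,d)) with 1 ≤ i < j ≤ q and (c,d) a nonzero integer vector. Let U ⊆ ℝ^{2q} be the linear subspace of tuples (x₁,y₁,…,x_q,y_q) satisfying d(x_j − x_i) = c(y_j − y_i) for every (i,j,(c,d)) ∈ S, and let f(n) = #{ z ∈ ℤ^{2q} : every coordinate of z lies in {1,…,n} and z ∈ U }. If p is a positive integer and p₀,…,p_{p−1} are polynomials with rational coefficients such that f(n) = p_{n mod p}(n) for every positive integer n, then for every integer n, p_{(−n) mod p}(−n) = (−1)^{dim U} · p_{n mod p}(n), where dim U is the dimension of U as a real vector space. In other words, the quasipolynomial extending f is an odd function of n if dim U is odd and an even function if dim U is even. -/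
/-- A function is annihilated by finitely many forward differences with steps in `S`. -/
inductive DiffAnnihilated {M G : Type*} [AddCommMonoid M] [AddCommGroup G] (S : Set M) :
    (M → G) → Prop
  | zero : DiffAnnihilated S 0
  | step (v : M) (φ : M → G) (hv : v ∈ S) (h : DiffAnnihilated S (fwdDiff v φ)) :
      DiffAnnihilated S φ

namespace DiffAnnihilated

section General

variable {M G : Type*} [AddCommMonoid M] [AddCommGroup G] {S : Set M} {φ ψ : M → G}

theorem of_periodic {v : M} (hv : v ∈ S) (h : ∀ x, φ (x + v) = φ x) : DiffAnnihilated S φ := by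
  refine step v φ hv ?_
  have : fwdDiff v φ = 0 := by
    ext x
    simp [fwdDiff, h]
  rw [this]
  exact zero

theorem fwdDiff (h : DiffAnnihilated S φ) (w : M) : DiffAnnihilated S (fwdDiff w φ) := by
  induction h with
  | zero =>
    have : _root_.fwdDiff w (0 : M → G) = 0 := by
      ext x
      simp [_root_.fwdDiff]
    rw [this]
    exact zero
  | step v φ hv _ ih =>
    refine step v _ hv ?_
    convert ih using 1
    ext x
    simp only [_root_.fwdDiff, add_right_comm x v w]
    abel

theorem add (hφ : DiffAnnihilated S φ) (hψ : DiffAnnihilated S ψ) :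
    DiffAnnihilated S (φ + ψ) := by
  induction hφ generalizing ψ with
  | zero => simpa using hψ
  | step v φ hv _ ih =>
    refine step v _ hv ?_
    rw [fwdDiff_add]
    exact ih (hψ.fwdDiff v)

theorem map {G' : Type*} [AddCommGroup G'] (g : G →+ G') (h : DiffAnnihilated S φ) :
    DiffAnnihilated S (fun x => g (φ x)) := by
  induction h with
  | zero =>
    convert zero
    simp
  | step v φ hv _ ih =>
    refine step v _ hv ?_
    convert ih using 1
    ext x
    simp [_root_.fwdDiff]

theorem sum {κ : Type*} (s : Finset κ) (φ : κ → M → G)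
    (h : ∀ k ∈ s, DiffAnnihilated S (φ k)) : DiffAnnihilated S (∑ k ∈ s, φ k) :=
  Finset.sum_induction φ (DiffAnnihilated S) (fun _ _ => add) zero h

theorem comp {M' : Type*} [AddCommMonoid M'] {S' : Set M'} (j : M' →+ M)
    (hj : ∀ v ∈ S, ∃ w ∈ S', j w = v) (h : DiffAnnihilated S φ) :
    DiffAnnihilated S' (φ ∘ j) := by
  induction h with
  | zero => exact zero
  | step v φ hv _ ih =>
    obtain ⟨w, hw, rfl⟩ := hj v hv
    refine step w _ hw ?_
    convert ih using 1
    ext x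
    simp [_root_.fwdDiff]

theorem comp_add_right (h : DiffAnnihilated S φ) (w : M) :
    DiffAnnihilated S (fun x => φ (x + w)) := by
  induction h with
  | zero => exact zero
  | step v φ hv _ ih =>
    refine step v _ hv ?_
    convert ih using 1
    ext x
    simp [_root_.fwdDiff, add_right_comm]

end General

theorem finsum_fiber {L G : Type*} [AddCommGroup L] [AddCommGroup G] {S : Set (L × ℤ)}
    {T : Set ℤ} (hST : ∀ v ∈ S, v.2 ∈ T) {φ : L × ℤ → G} (h : DiffAnnihilated S φ)
    (hfin : ∀ n, (Function.support fun z => φ (z, n)).Finite) :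
    DiffAnnihilated T (fun n => ∑ᶠ z, φ (z, n)) := by
  induction h with
  | zero =>
    convert zero
    simp
  | step v φ hv _ ih =>
    have hshift : ∀ n, (Function.support fun z => φ (z + v.1, n)).Finite := fun n =>
      ((hfin n).preimage (add_left_injective v.1).injOn :)
    refine step v.2 _ (hST v hv) ?_
    convert ih fun n => ((hshift (n + v.2)).union (hfin n)).subset ?_ using 1
    · ext n
      simp only [_root_.fwdDiff]
      have h1 := finsum_sub_distrib (hshift (n + v.2)) (hfin n)
      have h2 := finsum_comp_equiv (Equiv.addRight v.1) (f := fun z => φ (z, n + v.2))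
      simp only [Equiv.coe_addRight] at h2
      rw [h2] at h1
      exact h1.symm
    · exact Function.support_sub (fun z => φ (z + v.1, n + v.2)) (fun z => φ (z, n))

theorem eq_zero {G : Type*} [AddCommGroup G] {T : Set ℤ} (hT : ∀ a ∈ T, 0 < a) {φ : ℤ → G}
    (h : DiffAnnihilated T φ) (hφ : ∀ n, 0 < n → φ n = 0) : φ = 0 := by
  induction h with
  | zero => rfl
  | step a φ ha _ ih =>
    have hper : ∀ n, φ (n + a) = φ n := fun n =>
      sub_eq_zero.1 (congrFun (ih fun n hn => by
        simp [_root_.fwdDiff, hφ n hn, hφ (n + a) (by linarith [hT a ha])]) n)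
    have hiter : ∀ k : ℕ, ∀ n, φ (n + k * a) = φ n := by
      intro k
      induction k with
      | zero => simp
      | succ k ihk =>
        intro n
        rw [← ihk n, ← hper (n + k * a)]
        congr 1
        push_cast
        ring
    ext n
    rw [← hiter (n.natAbs + 1) n]
    refine hφ _ ?_
    have := hT a ha
    push_cast
    have h2 : (|n| + 1) * 1 ≤ (|n| + 1) * a := by gcongr; omega
    have := neg_abs_le n
    linarith

end DiffAnnihilated

section Cone

open Module

variable {V ι : Type*} [AddCommGroup V] [Module ℚ V]

open Classical in
/-- The difference between the indicator function of the open cone `{x ∈ W | ∀ i ∈ s, 0 < ℓ i x}`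
and `(-1) ^ dim W` times the indicator function of the opposite closed cone. -/
noncomputable def coneDefect (W : Submodule ℚ V) (s : Finset ι) (ℓ : ι → Dual ℚ V) (x : V) : ℚ :=
  if x ∈ W then
    (if ∀ i ∈ s, 0 < ℓ i x then 1 else 0) -
      (-1) ^ finrank ℚ W * (if ∀ i ∈ s, ℓ i x ≤ 0 then 1 else 0)
  else 0

theorem coneDefect_congr {W : Submodule ℚ V} {s s' : Finset ι} {ℓ ℓ' : ι → Dual ℚ V}
    (hpos : ∀ x ∈ W, (∀ i ∈ s, 0 < ℓ i x) ↔ ∀ i ∈ s', 0 < ℓ' i x)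
    (hnonpos : ∀ x ∈ W, (∀ i ∈ s, ℓ i x ≤ 0) ↔ ∀ i ∈ s', ℓ' i x ≤ 0) :
    coneDefect W s ℓ = coneDefect W s' ℓ' := by
  ext x
  unfold coneDefect
  split_ifs <;> first | rfl | (exfalso; simp_all)

theorem exists_dual_vectors {W : Submodule ℚ V} {s : Finset ι} {ℓ : ι → Dual ℚ V} {t : Dual ℚ V}
    [FiniteDimensional ℚ V]
    (hpt : ∀ x ∈ W, x ≠ 0 → (∀ i ∈ s, 0 ≤ ℓ i x) → 0 < t x)
    (hind : ∀ c : ι → ℚ, (∀ x ∈ W, ∑ i ∈ s, c i * ℓ i x = 0) → ∀ i ∈ s, c i = 0) :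
    finrank ℚ W = s.card ∧
      ∀ i ∈ s, ∃ v ∈ W, 0 < ℓ i v ∧ ∀ j ∈ s, j ≠ i → ℓ j v = 0 := by
  classical
  let T : W →ₗ[ℚ] (s → ℚ) := LinearMap.pi fun i => (ℓ i).domRestrict W
  have hT : ∀ x i, T x i = ℓ i x := fun x i => rfl
  have hinj : Function.Injective T := by
    rw [← LinearMap.ker_eq_bot, LinearMap.ker_eq_bot']
    intro x hx
    by_contra hne
    have hzero : ∀ i ∈ s, ℓ i x = 0 := fun i hi => congrFun hx ⟨i, hi⟩
    have hne' : (x : V) ≠ 0 := by simpa using hne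
    have h1 := hpt x x.2 hne' fun i hi => (hzero i hi).ge
    have h2 := hpt (-x) (W.neg_mem x.2) (neg_ne_zero.2 hne') fun i hi => by simp [hzero i hi]
    rw [map_neg] at h2
    linarith
  have hsurj : Function.Surjective T := by
    rw [← LinearMap.range_eq_top]
    by_contra hne
    obtain ⟨g, hg, hle⟩ := Submodule.exists_le_ker_of_lt_top _ (lt_top_iff_ne_top.2 hne)
    apply hg
    have hsingle : ∀ i : s, (Pi.single i 1 : s → ℚ) = fun j => if i = j then 1 else 0 := by
      intro i
      ext j
      simp [Pi.single_apply, eq_comm]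
    have hgsum : ∀ y, g y = ∑ i, y i * g (Pi.single i 1) := fun y => by
      simp only [hsingle]
      exact LinearMap.pi_apply_eq_sum_univ g y
    have hc := hind (fun i => if hi : i ∈ s then g (Pi.single ⟨i, hi⟩ 1) else 0) fun x hx => by
      have h0 : g (T ⟨x, hx⟩) = 0 := hle ⟨_, rfl⟩
      rw [hgsum] at h0
      rw [← h0, ← Finset.sum_coe_sort s]
      refine Finset.sum_congr rfl fun i _ => ?_
      simp [hT, mul_comm]
    ext i
    simpa using hc i i.2
  refine ⟨?_, fun i hi => ?_⟩
  · rw [(LinearEquiv.ofBijective T ⟨hinj, hsurj⟩).finrank_eq]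
    simp
  · obtain ⟨v, hv⟩ := hsurj (Pi.single ⟨i, hi⟩ 1)
    refine ⟨v, v.2, ?_, fun j hj hji => ?_⟩
    · have := congrFun hv ⟨i, hi⟩
      simp [hT] at this
      simp [this]
    · have := congrFun hv ⟨j, hj⟩
      rwa [hT, Pi.single_eq_of_ne (by simpa using hji)] at this

theorem diffAnnihilated_coneDefect_of_independent [FiniteDimensional ℚ V]
    {W : Submodule ℚ V} {s : Finset ι} {ℓ : ι → Dual ℚ V} {t : Dual ℚ V} {S : Set V}
    (hS : ∀ v, 0 < t v → ∃ k : ℕ, k • v ∈ S)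
    (hpt : ∀ x ∈ W, x ≠ 0 → (∀ i ∈ s, 0 ≤ ℓ i x) → 0 < t x)
    (hind : ∀ c : ι → ℚ, (∀ x ∈ W, ∑ i ∈ s, c i * ℓ i x = 0) → ∀ i ∈ s, c i = 0) :
    DiffAnnihilated S (coneDefect W s ℓ) := by
  classical
  obtain ⟨hrank, hdual⟩ := exists_dual_vectors hpt hind
  let h : ι → V → ℚ := fun i x => if 0 < ℓ i x then 1 else 0
  let φ : Finset ι → V → ℚ := fun r x =>
    if x ∈ W then (∏ i ∈ r, h i x) * ∏ i ∈ s \ r, (-1 : ℚ) else 0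
  have key : coneDefect W s ℓ = - ∑ r ∈ s.powerset.erase s, φ r := by
    ext x
    by_cases hx : x ∈ W
    swap
    · simp [coneDefect, φ, hx]
    have h1 : ∏ i ∈ s, h i x = if ∀ i ∈ s, 0 < ℓ i x then 1 else 0 := by
      rw [Finset.prod_ite_zero]
      simp
    have h2 : ∏ i ∈ s, (h i x + -1) =
        (-1) ^ s.card * if ∀ i ∈ s, ℓ i x ≤ 0 then 1 else 0 := by
      have : ∀ i, h i x + -1 = (-1) * if ℓ i x ≤ 0 then 1 else 0 := by
        intro i
        by_cases hi : 0 < ℓ i x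
        · simp [h, hi, not_le.2 hi]
        · simp [h, hi, not_lt.1 hi]
      simp_rw [this]
      rw [Finset.prod_mul_distrib, Finset.prod_ite_zero]
      simp
    have h3 := Finset.add_sum_erase s.powerset (fun r => φ r x) (Finset.mem_powerset_self s)
    have h4 : ∑ r ∈ s.powerset, φ r x = ∏ i ∈ s, (h i x + -1) := by
      rw [Finset.prod_add]
      simp [φ, hx]
    have h5 : φ s x = ∏ i ∈ s, h i x := by simp [φ, hx]
    simp only [coneDefect, hx, if_true, hrank, ← h1, ← h2, Pi.neg_apply, Finset.sum_apply,
      ← h4, ← h3, h5]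
    ring
  rw [key]
  refine (DiffAnnihilated.sum _ _ fun r hr => ?_).map (-AddMonoidHom.id ℚ)
  obtain ⟨hne, hsub⟩ := Finset.mem_erase.1 hr
  rw [Finset.mem_powerset] at hsub
  obtain ⟨i, his, hir⟩ : ∃ i ∈ s, i ∉ r := by
    by_contra! hcon
    exact hne (hsub.antisymm hcon)
  obtain ⟨v, hvW, hiv, hv⟩ := hdual i his
  have hne : v ≠ 0 := by
    rintro rfl
    simp at hiv
  obtain ⟨k, hk⟩ := hS v <| hpt v hvW hne fun j hj => by
    by_cases hji : j = i
    · exact hji ▸ hiv.le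
    · exact (hv j hj hji).ge
  refine DiffAnnihilated.of_periodic hk fun x => ?_
  have hW : x + k • v ∈ W ↔ x ∈ W := Submodule.add_mem_iff_left _ (W.smul_of_tower_mem k hvW)
  have hprod : ∏ j ∈ r, h j (x + k • v) = ∏ j ∈ r, h j x :=
    Finset.prod_congr rfl fun j hj => by
      simp [h, hv j (hsub hj) (by rintro rfl; exact hir hj)]
  simp only [φ, hW, hprod]

theorem finrank_inf_ker_add_one [FiniteDimensional ℚ V] {W : Submodule ℚ V} {u : Dual ℚ V} {z : V}
    (hz : z ∈ W) (huz : u z ≠ 0) :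
    finrank ℚ (W ⊓ LinearMap.ker u : Submodule ℚ V) + 1 = finrank ℚ W := by
  have hne : u.domRestrict W ≠ 0 := fun h => huz (LinearMap.congr_fun h ⟨z, hz⟩)
  rw [← Module.Dual.finrank_ker_add_one_of_ne_zero hne, ← Submodule.map_comap_subtype,
    Submodule.finrank_map_subtype_eq]
  rfl

theorem exists_pos_add_smul {s : Finset ι} {ℓ : ι → Dual ℚ V} {x : V} (hx : ∀ i ∈ s, 0 < ℓ i x)
    (z : V) : ∃ ε : ℚ, 0 < ε ∧ ∀ i ∈ s, 0 < ℓ i (x + ε • z) := by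
  classical
  induction s using Finset.induction_on with
  | empty => exact ⟨1, one_pos, by simp⟩
  | insert a s _ ih =>
    obtain ⟨ε, hε, h⟩ := ih fun i hi => hx i (Finset.mem_insert_of_mem hi)
    have ha := hx a (Finset.mem_insert_self a s)
    have hA : 0 < |ℓ a z| + 1 := by positivity
    refine ⟨min ε (ℓ a x / (|ℓ a z| + 1)), by positivity, fun i hi => ?_⟩
    have hpos : 0 < min ε (ℓ a x / (|ℓ a z| + 1)) := by positivity
    rw [map_add, map_smul, smul_eq_mul]
    obtain rfl | hi' := Finset.mem_insert.1 hi
    · have h1 : min ε (ℓ i x / (|ℓ i z| + 1)) * (|ℓ i z| + 1) ≤ ℓ i x := by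
        rw [← le_div_iff₀ hA]
        exact min_le_right _ _
      have := neg_abs_le (ℓ i z)
      nlinarith
    · have h1 := h i hi'
      have h2 := hx i hi
      rw [map_add, map_smul, smul_eq_mul] at h1
      have h3 := min_le_left ε (ℓ a x / (|ℓ a z| + 1))
      rcases le_total 0 (ℓ i z) with h4 | h4
      · positivity
      · nlinarith

theorem pos_of_nonneg_on_cone {W : Submodule ℚ V} {s : Finset ι} {ℓ : ι → Dual ℚ V}
    {u : Dual ℚ V} {z : V} (hz : z ∈ W) (huz : u z ≠ 0)
    (h : ∀ x ∈ W, (∀ i ∈ s, 0 < ℓ i x) → 0 ≤ u x) :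
    ∀ x ∈ W, (∀ i ∈ s, 0 < ℓ i x) → 0 < u x := by
  intro x hx hpos
  refine lt_of_le_of_ne (h x hx hpos) fun h0 => ?_
  obtain ⟨ε, hε, h1⟩ := exists_pos_add_smul hpos (-(u z) • z)
  have h2 := h _ (W.add_mem hx (W.smul_mem _ (W.smul_mem _ hz))) h1
  simp only [map_add, ← h0, map_smul, smul_eq_mul, zero_add] at h2
  have : 0 < ε * (u z * u z) := mul_pos hε (mul_self_pos.2 huz)
  linarith

theorem nonpos_of_pos_on_cone {W : Submodule ℚ V} {s : Finset ι} {ℓ : ι → Dual ℚ V}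
    {u : Dual ℚ V} (hne : ∃ x ∈ W, ∀ i ∈ s, 0 < ℓ i x)
    (h : ∀ x ∈ W, (∀ i ∈ s, 0 < ℓ i x) → 0 < u x) :
    ∀ x ∈ W, (∀ i ∈ s, ℓ i x ≤ 0) → u x ≤ 0 := by
  intro x hx hnp
  obtain ⟨y, hy, hypos⟩ := hne
  by_contra! hux
  have huy := h y hy hypos
  have := h (u x • y - (2 * u y) • x) (W.sub_mem (W.smul_mem _ hy) (W.smul_mem _ hx))
    fun i hi => by
      simp only [map_sub, map_smul, smul_eq_mul]
      have h1 := mul_pos hux (hypos i hi)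
      have h2 := mul_nonneg huy.le (neg_nonneg.2 (hnp i hi))
      linarith
  simp only [map_sub, map_smul, smul_eq_mul] at this
  nlinarith

theorem forall_update_pos_iff [DecidableEq ι] {s : Finset ι} {ℓ : ι → Dual ℚ V} {c : ι → ℚ}
    {i j : ι} (hi : i ∈ s) (hj : j ∈ s) (hij : i ≠ j) (hci : 0 < c i) (hcj : c j < 0) (x : V) :
    (∀ k ∈ s, 0 < Function.update ℓ i (c i • ℓ i + c j • ℓ j) k x) ↔
      (∀ k ∈ s, 0 < ℓ k x) ∧ 0 < (c i • ℓ i + c j • ℓ j) x := by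
  constructor
  · intro h
    have hu := h i hi
    have hjx := h j hj
    rw [Function.update_self] at hu
    rw [Function.update_of_ne hij.symm] at hjx
    refine ⟨fun k hk => ?_, hu⟩
    by_cases hki : k = i
    · subst hki
      simp only [LinearMap.add_apply, LinearMap.smul_apply, smul_eq_mul] at hu
      have : 0 < c k * ℓ k x := by nlinarith
      exact (pos_iff_pos_of_mul_pos this).1 hci
    · simpa [Function.update_of_ne hki] using h k hk
  · rintro ⟨h, hu⟩ k hk
    by_cases hki : k = i
    · subst hki
      rwa [Function.update_self]
    · simpa [Function.update_of_ne hki] using h k hk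

theorem forall_update_nonneg_iff [DecidableEq ι] {s : Finset ι} {ℓ : ι → Dual ℚ V} {c : ι → ℚ}
    {i j : ι} (hi : i ∈ s) (hj : j ∈ s) (hij : i ≠ j) (hci : 0 < c i) (hcj : c j < 0) (x : V) :
    (∀ k ∈ s, 0 ≤ Function.update ℓ i (c i • ℓ i + c j • ℓ j) k x) ↔
      (∀ k ∈ s, 0 ≤ ℓ k x) ∧ 0 ≤ (c i • ℓ i + c j • ℓ j) x := by
  constructor
  · intro h
    have hu := h i hi
    have hjx := h j hj
    rw [Function.update_self] at hu
    rw [Function.update_of_ne hij.symm] at hjx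
    refine ⟨fun k hk => ?_, hu⟩
    by_cases hki : k = i
    · subst hki
      simp only [LinearMap.add_apply, LinearMap.smul_apply, smul_eq_mul] at hu
      have : 0 ≤ c k * ℓ k x := by nlinarith
      exact nonneg_of_mul_nonneg_right this hci
    · simpa [Function.update_of_ne hki] using h k hk
  · rintro ⟨h, hu⟩ k hk
    by_cases hki : k = i
    · subst hki
      rwa [Function.update_self]
    · simpa [Function.update_of_ne hki] using h k hk

theorem forall_update_nonpos_iff [DecidableEq ι] {s : Finset ι} {ℓ : ι → Dual ℚ V} {c : ι → ℚ}
    {i j : ι} (hi : i ∈ s) (hj : j ∈ s) (hij : i ≠ j) (hci : 0 < c i) (hcj : c j < 0) (x : V) :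
    (∀ k ∈ s, Function.update ℓ i (c i • ℓ i + c j • ℓ j) k x ≤ 0) ↔
      (∀ k ∈ s, ℓ k x ≤ 0) ∧ (c i • ℓ i + c j • ℓ j) x ≤ 0 := by
  simpa only [map_neg, Left.nonneg_neg_iff] using
    forall_update_nonneg_iff (ℓ := ℓ) hi hj hij hci hcj (-x)

/-- Cutting a cone along a hyperplane that passes through its interior. -/
theorem coneDefect_cut [FiniteDimensional ℚ V] {W : Submodule ℚ V} {s : Finset ι}
    {ℓ ℓ₁ ℓ₂ : ι → Dual ℚ V} {u : Dual ℚ V} {z : V} (hz : z ∈ W) (huz : u z ≠ 0)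
    (hpos₁ : ∀ x, (∀ k ∈ s, 0 < ℓ₁ k x) ↔ (∀ k ∈ s, 0 < ℓ k x) ∧ 0 < u x)
    (hnonpos₁ : ∀ x, (∀ k ∈ s, ℓ₁ k x ≤ 0) ↔ (∀ k ∈ s, ℓ k x ≤ 0) ∧ u x ≤ 0)
    (hpos₂ : ∀ x, (∀ k ∈ s, 0 < ℓ₂ k x) ↔ (∀ k ∈ s, 0 < ℓ k x) ∧ 0 < (-u) x)
    (hnonpos₂ : ∀ x, (∀ k ∈ s, ℓ₂ k x ≤ 0) ↔ (∀ k ∈ s, ℓ k x ≤ 0) ∧ (-u) x ≤ 0) :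
    coneDefect W s ℓ = coneDefect W s ℓ₁ + coneDefect W s ℓ₂ +
      coneDefect (W ⊓ LinearMap.ker u) s ℓ := by
  ext x
  by_cases hx : x ∈ W
  swap
  · simp [coneDefect, hx]
  have hdim := finrank_inf_ker_add_one hz huz
  simp only [coneDefect, Pi.add_apply, hx, if_true, hpos₁, hpos₂, hnonpos₁, hnonpos₂,
    Submodule.mem_inf, true_and, LinearMap.mem_ker, ← hdim, pow_succ, LinearMap.neg_apply,
    Left.neg_pos_iff, Left.neg_nonpos_iff]
  rcases lt_trichotomy (u x) 0 with h | h | h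
  · simp only [h, h.le, h.ne, not_lt.2 h.le, not_le.2 h, and_true, and_false, if_false]
    ring
  · simp only [h, lt_irrefl, le_refl, and_true, and_false, if_false, if_true]
    ring
  · simp only [h, h.le, h.ne', not_lt.2 h.le, not_le.2 h, and_true, and_false, if_false]
    ring

theorem diffAnnihilated_coneDefect_of_relation [FiniteDimensional ℚ V]
    {W : Submodule ℚ V} {s : Finset ι} {t : Dual ℚ V} {S : Set V}
    (hdim : ∀ W' : Submodule ℚ V, finrank ℚ W' < finrank ℚ W → ∀ ℓ : ι → Dual ℚ V,
      (∃ x ∈ W', ∀ i ∈ s, 0 < ℓ i x) →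
      (∀ x ∈ W', x ≠ 0 → (∀ i ∈ s, 0 ≤ ℓ i x) → 0 < t x) → DiffAnnihilated S (coneDefect W' s ℓ))
    (hcard : ∀ s' ⊂ s, ∀ ℓ : ι → Dual ℚ V, (∃ x ∈ W, ∀ i ∈ s', 0 < ℓ i x) →
      (∀ x ∈ W, x ≠ 0 → (∀ i ∈ s', 0 ≤ ℓ i x) → 0 < t x) → DiffAnnihilated S (coneDefect W s' ℓ))
    (N : ℕ) (ℓ : ι → Dual ℚ V) (c : ι → ℚ) (hN : {i ∈ s | c i ≠ 0}.card = N)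
    (hne : ∃ x ∈ W, ∀ i ∈ s, 0 < ℓ i x)
    (hpt : ∀ x ∈ W, x ≠ 0 → (∀ i ∈ s, 0 ≤ ℓ i x) → 0 < t x)
    (hrel : ∀ x ∈ W, ∑ i ∈ s, c i * ℓ i x = 0) (hc : ∃ i ∈ s, c i ≠ 0) :
    DiffAnnihilated S (coneDefect W s ℓ) := by
  classical
  induction N using Nat.strong_induction_on generalizing ℓ c with
  | _ N ih =>
  have half : ∀ (c : ι → ℚ) (_ : {i ∈ s | c i ≠ 0}.card = N)
      (_ : ∀ x ∈ W, ∑ i ∈ s, c i * ℓ i x = 0) (i j : ι) (_ : i ∈ s) (_ : j ∈ s)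
      (_ : 0 < c i) (_ : c j < 0) (_ : i ≠ j)
      (_ : ∃ x ∈ W, (∀ k ∈ s, 0 < ℓ k x) ∧ 0 < (c i • ℓ i + c j • ℓ j) x),
      DiffAnnihilated S
        (coneDefect W s (Function.update ℓ i (c i • ℓ i + c j • ℓ j))) := by
    intro c hN hrel i j hi hj hci hcj hij hex
    obtain ⟨y, hyW, hy⟩ := hex
    refine ih _ ?_ _ (Function.update (Function.update c i 1) j 0) rfl
      ⟨y, hyW, (forall_update_pos_iff hi hj hij hci hcj y).2 hy⟩
      (fun x hx hx0 h => hpt x hx hx0 ((forall_update_nonneg_iff hi hj hij hci hcj x).1 h).1)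
      (fun x hx => ?_) ⟨i, hi, by simp [hij]⟩
    · rw [← hN]
      refine Finset.card_lt_card (Finset.ssubset_iff_of_subset (fun k hk => ?_) |>.2 ⟨j, ?_, ?_⟩)
      · rw [Finset.mem_filter] at hk ⊢
        refine ⟨hk.1, ?_⟩
        by_cases hkj : k = j
        · exact hkj ▸ hcj.ne
        by_cases hki : k = i
        · exact hki ▸ hci.ne'
        simpa [hkj, hki] using hk.2
      · simp [hj, hcj.ne]
      · simp
    · have : ∀ k ∈ s, Function.update (Function.update c i 1) j 0 k *
          Function.update ℓ i (c i • ℓ i + c j • ℓ j) k x =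
          c k * ℓ k x + (if k = i then c j * ℓ j x else 0) -
            (if k = j then c j * ℓ j x else 0) := by
        intro k _
        by_cases hkj : k = j
        · subst hkj
          simp [hij.symm]
        by_cases hki : k = i
        · subst hki
          simp [hij]
        simp [hkj, hki]
      rw [Finset.sum_congr rfl this, Finset.sum_sub_distrib, Finset.sum_add_distrib, hrel x hx]
      simp [hi, hj]
  obtain ⟨y, hyW, hy⟩ := hne
  obtain ⟨a, ha, hca⟩ := hc
  have hca' : c a * ℓ a y ≠ 0 := mul_ne_zero hca (hy a ha).ne'
  obtain ⟨i, hi, hci⟩ := Finset.exists_pos_of_sum_zero_of_exists_nonzero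
    (fun i => c i * ℓ i y) (hrel y hyW) ⟨a, ha, hca'⟩
  obtain ⟨j, hj, hcj⟩ := Finset.exists_pos_of_sum_zero_of_exists_nonzero
    (fun i => -(c i * ℓ i y)) (by rw [Finset.sum_neg_distrib, hrel y hyW, neg_zero])
    ⟨a, ha, neg_ne_zero.2 hca'⟩
  replace hci : 0 < c i := (pos_iff_pos_of_mul_pos hci).2 (hy i hi)
  replace hcj : c j < 0 := by
    have := hy j hj
    by_contra! h
    have := mul_nonneg h this.le
    linarith
  have hij : i ≠ j := by
    rintro rfl
    linarith
  set u := c i • ℓ i + c j • ℓ j with hu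
  have hneg : (-c) j • ℓ j + (-c) i • ℓ i = -u := by
    rw [hu]
    simp only [Pi.neg_apply]
    module
  have hcj' : 0 < (-c) j := by simpa using hcj
  have hci' : (-c) i < 0 := by simpa using hci
  have half₁ := half c hN hrel i j hi hj hci hcj hij
  have half₂ := half (-c) (by simpa using hN)
    (fun x hx => by simpa [Finset.sum_neg_distrib] using hrel x hx) j i hj hi hcj' hci' hij.symm
  have hpos₁ := forall_update_pos_iff (ℓ := ℓ) hi hj hij hci hcj
  have hnonpos₁ := forall_update_nonpos_iff (ℓ := ℓ) hi hj hij hci hcj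
  have hpos₂ := forall_update_pos_iff (ℓ := ℓ) hj hi hij.symm hcj' hci'
  have hnonpos₂ := forall_update_nonpos_iff (ℓ := ℓ) hj hi hij.symm hcj' hci'
  rw [hneg] at half₂ hpos₂ hnonpos₂
  rw [← hu] at half₁ hpos₁ hnonpos₁
  by_cases hu0 : ∀ x ∈ W, u x = 0
  · have hlin : ∀ x ∈ W, c i * ℓ i x = -c j * ℓ j x := fun x hx => by
      have := hu0 x hx
      simp only [hu, LinearMap.add_apply, LinearMap.smul_apply, smul_eq_mul] at this
      linarith
    have hj' : j ∈ s.erase i := Finset.mem_erase.2 ⟨hij.symm, hj⟩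
    have hins : ∀ p : ι → Prop, (∀ k ∈ s, p k) ↔ p i ∧ ∀ k ∈ s.erase i, p k := fun p => by
      rw [← Finset.forall_mem_insert, Finset.insert_erase hi]
    have hposW : ∀ x ∈ W, (∀ k ∈ s, 0 < ℓ k x) ↔ ∀ k ∈ s.erase i, 0 < ℓ k x := by
      intro x hx
      rw [hins fun k => 0 < ℓ k x]
      refine and_iff_right_of_imp fun h => ?_
      have h1 : 0 < c i * ℓ i x := hlin x hx ▸ mul_pos hcj' (h j hj')
      exact (pos_iff_pos_of_mul_pos h1).1 hci
    have hnonnegW : ∀ x ∈ W, (∀ k ∈ s, 0 ≤ ℓ k x) ↔ ∀ k ∈ s.erase i, 0 ≤ ℓ k x := by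
      intro x hx
      rw [hins fun k => 0 ≤ ℓ k x]
      refine and_iff_right_of_imp fun h => ?_
      have h1 : 0 ≤ c i * ℓ i x := hlin x hx ▸ mul_nonneg hcj'.le (h j hj')
      exact nonneg_of_mul_nonneg_right h1 hci
    rw [coneDefect_congr hposW fun x hx => by simpa using hnonnegW (-x) (W.neg_mem hx)]
    exact hcard _ (Finset.erase_ssubset hi) ℓ ⟨y, hyW, (hposW y hyW).1 hy⟩
      fun x hx hx0 h => hpt x hx hx0 ((hnonnegW x hx).2 h)
  push Not at hu0
  obtain ⟨z, hz, huz⟩ := hu0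
  by_cases hex₁ : ∃ x ∈ W, (∀ k ∈ s, 0 < ℓ k x) ∧ 0 < u x
  swap
  · push Not at hex₁
    have hall := pos_of_nonneg_on_cone (u := -u) hz (by simpa using huz)
      fun x hx h => by simpa using hex₁ x hx h
    have hle := nonpos_of_pos_on_cone ⟨y, hyW, hy⟩ hall
    rw [coneDefect_congr (s := s) (ℓ := ℓ) (s' := s) (ℓ' := Function.update ℓ j (-u))
      (fun x hx => by rw [hpos₂]; exact (and_iff_left_of_imp (hall x hx)).symm)
      (fun x hx => by rw [hnonpos₂]; exact (and_iff_left_of_imp (hle x hx)).symm)]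
    exact half₂ ⟨y, hyW, hy, hall y hyW hy⟩
  by_cases hex₂ : ∃ x ∈ W, (∀ k ∈ s, 0 < ℓ k x) ∧ 0 < (-u) x
  swap
  · push Not at hex₂
    have hall := pos_of_nonneg_on_cone hz huz fun x hx h => by simpa using hex₂ x hx h
    have hle := nonpos_of_pos_on_cone ⟨y, hyW, hy⟩ hall
    rw [coneDefect_congr (s := s) (ℓ := ℓ) (s' := s) (ℓ' := Function.update ℓ i u)
      (fun x hx => by rw [hpos₁]; exact (and_iff_left_of_imp (hall x hx)).symm)
      (fun x hx => by rw [hnonpos₁]; exact (and_iff_left_of_imp (hle x hx)).symm)]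
    exact half₁ hex₁
  rw [coneDefect_cut hz huz hpos₁ hnonpos₁ hpos₂ hnonpos₂]
  refine ((half₁ hex₁).add (half₂ hex₂)).add (hdim _ ?_ ℓ ?_ fun x hx => hpt x hx.1)
  · have := finrank_inf_ker_add_one hz huz
    omega
  · obtain ⟨x₁, hx₁, hp₁, hu₁⟩ := hex₁
    obtain ⟨x₂, hx₂, hp₂, hu₂⟩ := hex₂
    refine ⟨(-u) x₂ • x₁ + u x₁ • x₂,
      ⟨W.add_mem (W.smul_mem _ hx₁) (W.smul_mem _ hx₂), ?_⟩, fun k hk => ?_⟩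
    · simp only [SetLike.mem_coe, LinearMap.mem_ker, LinearMap.neg_apply, map_add, map_smul,
        smul_eq_mul]
      ring
    · simp only [map_add, map_smul, smul_eq_mul]
      exact add_pos (mul_pos hu₂ (hp₁ k hk)) (mul_pos hu₁ (hp₂ k hk))

/-- Reciprocity for rational cones: up to functions annihilated by forward differences, the
indicator function of an open pointed cone is `± 1` times that of the opposite closed cone. -/
theorem diffAnnihilated_coneDefect [FiniteDimensional ℚ V] {t : Dual ℚ V} {S : Set V}
    (hS : ∀ v, 0 < t v → ∃ k : ℕ, k • v ∈ S) (W : Submodule ℚ V) (s : Finset ι)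
    (ℓ : ι → Dual ℚ V) (hne : ∃ x ∈ W, ∀ i ∈ s, 0 < ℓ i x)
    (hpt : ∀ x ∈ W, x ≠ 0 → (∀ i ∈ s, 0 ≤ ℓ i x) → 0 < t x) :
    DiffAnnihilated S (coneDefect W s ℓ) := by
  induction hd : finrank ℚ W using Nat.strong_induction_on generalizing W s ℓ with
  | _ d ihd =>
  induction s using Finset.strongInduction generalizing ℓ with
  | _ s ihs =>
  by_cases hind : ∀ c : ι → ℚ, (∀ x ∈ W, ∑ i ∈ s, c i * ℓ i x = 0) → ∀ i ∈ s, c i = 0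
  · exact diffAnnihilated_coneDefect_of_independent hS hpt hind
  · push Not at hind
    obtain ⟨c, hrel, hc⟩ := hind
    exact diffAnnihilated_coneDefect_of_relation
      (fun W' hW' ℓ' hne' hpt' => ihd _ (hd ▸ hW') W' s ℓ' hne' hpt' rfl)
      (fun s' hs' ℓ' hne' hpt' => ihs s' hs' ℓ' hne' hpt') _ ℓ c rfl hne hpt hrel hc

end Cone

section Ehrhart

open Module

variable {m ι : Type*} [Fintype ι]

/-- The integer points of the box `[a, b]ⁱ` in the kernel of `A`. -/
def boxKernel (A : Matrix m ι ℤ) (a b : ℤ) : Set (ι → ℤ) :=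
  {z | (∀ i, z i ∈ Set.Icc a b) ∧ A.mulVec z = 0}

theorem boxKernel_finite (A : Matrix m ι ℤ) (a b : ℤ) : (boxKernel A a b).Finite :=
  (Set.Finite.pi' fun _ : ι => Set.finite_Icc a b).subset fun _ hz => hz.1

theorem ncard_boxKernel_add {A : Matrix m ι ℤ} (hA : A.mulVec 1 = 0) (a b k : ℤ) :
    (boxKernel A (a + k) (b + k)).ncard = (boxKernel A a b).ncard := by
  have hk : A.mulVec (k • (1 : ι → ℤ)) = 0 := by rw [Matrix.mulVec_smul, hA, smul_zero]
  have : boxKernel A (a + k) (b + k) = (fun z => z + k • (1 : ι → ℤ)) '' boxKernel A a b := by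
    ext z
    constructor
    · rintro ⟨h1, h2⟩
      refine ⟨z - k • 1, ⟨fun i => ?_, ?_⟩, by simp⟩
      · have := h1 i
        simp only [Set.mem_Icc, Pi.sub_apply, Pi.smul_apply, Pi.one_apply, smul_eq_mul] at this ⊢
        constructor <;> linarith
      · rw [Matrix.mulVec_sub, h2, hk, sub_zero]
    · rintro ⟨y, ⟨h1, h2⟩, rfl⟩
      refine ⟨fun i => ?_, ?_⟩
      · have := h1 i
        simp only [Set.mem_Icc, Pi.add_apply, Pi.smul_apply, Pi.one_apply, smul_eq_mul] at this ⊢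
        constructor <;> linarith
      · rw [Matrix.mulVec_add, h2, hk, add_zero]
  rw [this, Set.ncard_image_of_injective _ (add_left_injective _)]

theorem boxKernel_eq_empty [Nonempty ι] (A : Matrix m ι ℤ) {a b : ℤ} (hab : b < a) :
    boxKernel A a b = ∅ := by
  ext z
  simp only [Set.mem_empty_iff_false, iff_false]
  rintro ⟨h, -⟩
  have := h (Classical.arbitrary ι)
  simp only [Set.mem_Icc] at this
  omega

/-- The inclusion of the integer lattice. -/
def latticeHom (ι : Type*) : (ι → ℤ) × ℤ →+ (ι → ℚ) × ℚ where
  toFun v := (fun i => v.1 i, v.2)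
  map_zero' := by ext <;> simp
  map_add' v w := by ext <;> simp

theorem exists_nsmul_eq_latticeHom {v : (ι → ℚ) × ℚ} (hv : 0 < v.2) :
    ∃ k : ℕ, ∃ w, 0 < w.2 ∧ latticeHom ι w = k • v := by
  have hint : ∀ (k : ℕ) (x : ℚ), x.den ∣ k → ∃ a : ℤ, (a : ℚ) = k * x := by
    rintro _ x ⟨c, rfl⟩
    refine ⟨x.num * c, ?_⟩
    have := x.mul_den_eq_num
    push_cast
    rw [← this]
    ring
  set k := v.2.den * ∏ i, (v.1 i).den with hk
  have hk0 : 0 < k := mul_pos v.2.den_pos (Finset.prod_pos fun i _ => (v.1 i).den_pos)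
  obtain ⟨b, hb⟩ := hint k v.2 (Dvd.intro _ rfl)
  choose a ha using fun i => hint k (v.1 i)
    ((Finset.dvd_prod_of_mem (fun i => (v.1 i).den) (Finset.mem_univ i)).mul_left _)
  refine ⟨k, (a, b), ?_, ?_⟩
  · have : (0 : ℚ) < b := hb ▸ by positivity
    exact_mod_cast this
  · ext <;> simp [latticeHom, ha, hb]

/-- The linear forms cutting out the cone over the unit cube. -/
def cubeForm (ι : Type*) : ι ⊕ ι → Dual ℚ ((ι → ℚ) × ℚ)
  | .inl i => LinearMap.proj i ∘ₗ LinearMap.fst ℚ _ _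
  | .inr i => LinearMap.snd ℚ _ _ - LinearMap.proj i ∘ₗ LinearMap.fst ℚ _ _

theorem diffAnnihilated_ncard_boxKernel [Nonempty ι] {A : Matrix m ι ℤ} (hA : A.mulVec 1 = 0) :
    DiffAnnihilated {a : ℤ | 0 < a} fun n => ((boxKernel A 1 (n - 1)).ncard : ℚ) +
      (-1) ^ finrank ℚ (LinearMap.ker (A.map (Int.cast : ℤ → ℚ)).mulVecLin) *
        ((boxKernel A n 0).ncard : ℚ) := by
  classical
  set K := LinearMap.ker (A.map (Int.cast : ℤ → ℚ)).mulVecLin with hK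
  let W : Submodule ℚ ((ι → ℚ) × ℚ) := K.prod ⊤
  have hW : finrank ℚ W = finrank ℚ K + 1 := by
    let e : W ≃ₗ[ℚ] K × ℚ :=
      { toFun x := (⟨x.1.1, x.2.1⟩, x.1.2)
        invFun y := ⟨(y.1.1, y.2), y.1.2, trivial⟩
        map_add' _ _ := rfl
        map_smul' _ _ := rfl }
    rw [e.finrank_eq, finrank_prod, finrank_self]
  have hcast : ∀ z : ι → ℤ, (fun i => (z i : ℚ)) ∈ K ↔ A.mulVec z = 0 := by
    intro z
    rw [hK, LinearMap.mem_ker, Matrix.mulVecLin_apply]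
    have : (A.map (Int.cast : ℤ → ℚ)).mulVec (fun i => (z i : ℚ)) =
        fun i => ((A.mulVec z i : ℤ) : ℚ) := by
      ext i
      simp [Matrix.mulVec, dotProduct]
    rw [this]
    simp [funext_iff]
  have hone : (fun _ => (1 : ℚ)) ∈ K := by
    have := (hcast 1).2 hA
    simpa using this
  have hcone := diffAnnihilated_coneDefect
    (t := LinearMap.snd ℚ (ι → ℚ) ℚ) (S := latticeHom ι '' {w | 0 < w.2})
    (fun v hv => by
      obtain ⟨k, w, hw, h⟩ := exists_nsmul_eq_latticeHom hv
      exact ⟨k, w, hw, h⟩)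
    W Finset.univ (cubeForm ι)
    ⟨(fun _ => 1, 2), ⟨hone, trivial⟩, by
      rintro (i | i) -
      · simp [cubeForm]
      · norm_num [cubeForm]⟩
    (fun x _ hx0 h => by
      have h1 : ∀ i, 0 ≤ x.1 i := fun i => by simpa [cubeForm] using h (.inl i)
      have h2 : ∀ i, x.1 i ≤ x.2 := fun i => by simpa [cubeForm] using h (.inr i)
      have h3 : 0 ≤ x.2 := (h1 (Classical.arbitrary ι)).trans (h2 _)
      refine lt_of_le_of_ne h3 fun h4 => hx0 (Prod.ext (funext fun i => ?_) h4.symm)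
      exact le_antisymm ((h2 i).trans_eq h4.symm) (h1 i))
  have hval : ∀ z n, (coneDefect W Finset.univ (cubeForm ι) ∘ latticeHom ι) (z, n) =
      (boxKernel A 1 (n - 1)).indicator 1 z +
        (-1) ^ finrank ℚ K * (boxKernel A n 0).indicator 1 z := by
    intro z n
    have hmem : latticeHom ι (z, n) ∈ W ↔ A.mulVec z = 0 :=
      (Submodule.mem_prod.trans (and_iff_left Submodule.mem_top)).trans (hcast z)
    have hpos : (∀ i ∈ Finset.univ, 0 < cubeForm ι i (latticeHom ι (z, n))) ↔
        ∀ i, z i ∈ Set.Icc 1 (n - 1) := by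
      simp only [Finset.mem_univ, true_imp_iff, Sum.forall, cubeForm, latticeHom, Set.mem_Icc,
        ← forall_and]
      refine forall_congr' fun i => and_congr ?_ ?_
      · simp [Int.lt_iff_add_one_le]
      · rw [Int.le_sub_one_iff]
        simp
    have hnonpos : (∀ i ∈ Finset.univ, cubeForm ι i (latticeHom ι (z, n)) ≤ 0) ↔
        ∀ i, z i ∈ Set.Icc n 0 := by
      simp only [Finset.mem_univ, true_imp_iff, Sum.forall, cubeForm, latticeHom, Set.mem_Icc,
        ← forall_and]
      refine forall_congr' fun i => and_comm.trans (and_congr ?_ ?_)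
      · simp
      · simp
    simp only [Function.comp_apply, coneDefect, hmem, hpos, hnonpos, hW, pow_succ, boxKernel,
      Set.indicator_apply, Set.mem_ofPred_eq, Pi.one_apply]
    by_cases hz : A.mulVec z = 0
    · simp only [hz, and_true, if_true]
      ring
    · simp [hz]
  have hsupp : ∀ n, (Function.support fun z =>
      (coneDefect W Finset.univ (cubeForm ι) ∘ latticeHom ι) (z, n)).Finite := by
    intro n
    refine ((boxKernel_finite A 1 (n - 1)).union (boxKernel_finite A n 0)).subset fun z hz => ?_
    by_contra hcon
    rw [Set.mem_union, not_or] at hcon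
    exact hz (by simp only [hval, Set.indicator_of_notMem hcon.1,
      Set.indicator_of_notMem hcon.2, mul_zero, add_zero])
  have hlattice := hcone.comp (S' := {w : (ι → ℤ) × ℤ | 0 < w.2}) (latticeHom ι)
    (by
      rintro _ ⟨w, hw, rfl⟩
      exact ⟨w, hw, rfl⟩)
  have hpush := hlattice.finsum_fiber (T := {a : ℤ | 0 < a}) (fun _ h => h) hsupp
  convert hpush using 2 with n
  have hcount : ∀ a b, ∑ᶠ z, (boxKernel A a b).indicator (1 : (ι → ℤ) → ℚ) z =
      (boxKernel A a b).ncard := by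
    intro a b
    rw [← finsum_mem_def]
    simp [Set.ncard_eq_toFinset_card _ (boxKernel_finite A a b),
      finsum_mem_eq_finite_toFinset_sum _ (boxKernel_finite A a b)]
  have hfin : ∀ a b, (Function.support
      ((boxKernel A a b).indicator (1 : (ι → ℤ) → ℚ))).Finite := fun a b =>
    (boxKernel_finite A a b).subset Set.support_indicator_subset
  simp_rw [hval]
  rw [finsum_add_distrib (hfin _ _)
    ((hfin _ _).subset (Function.support_mul_subset_right _ _)), ← mul_finsum, hcount, hcount]

theorem diffAnnihilated_quasipolynomial {p : ℕ} (hp : 0 < p) (P : ℕ → Polynomial ℚ) :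
    DiffAnnihilated {a : ℤ | 0 < a} fun n : ℤ => (P (n % (p : ℤ)).toNat).eval (n : ℚ) := by
  have hiter : ∀ (N : ℕ) (φ : ℤ → ℚ), (fwdDiff (p : ℤ))^[N] φ = 0 →
      DiffAnnihilated {a : ℤ | 0 < a} φ := by
    intro N
    induction N with
    | zero =>
      rintro φ (rfl : φ = 0)
      exact .zero
    | succ N ih => exact fun φ h => .step (p : ℤ) φ (Int.natCast_pos.2 hp) (ih _ h)
  refine hiter ((Finset.range p).sup (fun r => (P r).natDegree) + 1) _ ?_
  ext n
  set N := (Finset.range p).sup (fun r => (P r).natDegree) + 1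
  set r := (n % (p : ℤ)).toNat with hr
  have hrp : r < p := by
    have := Int.emod_lt_of_pos n (show (0 : ℤ) < p by exact_mod_cast hp)
    omega
  let R := (P r).comp (Polynomial.C (p : ℚ) * Polynomial.X + Polynomial.C (n : ℚ))
  have hR : R.natDegree < N := by
    refine Nat.lt_succ_of_le (Polynomial.natDegree_comp_le.trans ?_)
    calc _ ≤ (P r).natDegree * 1 := by gcongr; exact Polynomial.natDegree_linear_le
      _ ≤ _ := by
        rw [mul_one]
        exact Finset.le_sup (f := fun r => (P r).natDegree) (Finset.mem_range.2 hrp)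
  have h0 := congrFun (Polynomial.fwdDiff_iter_eq_zero_of_degree_lt hR) 0
  rw [fwdDiff_iter_eq_sum_shift] at h0 ⊢
  rw [Pi.zero_apply] at h0 ⊢
  rw [← h0]
  refine Finset.sum_congr rfl fun k _ => ?_
  have : (n + k • (p : ℤ)) % (p : ℤ) = n % p := by simp
  rw [this, ← hr]
  simp [R, add_comm, mul_comm]

/-- Ehrhart reciprocity for the sections of cubes by rational subspaces that contain the diagonal
of the cube. -/
theorem quasipolynomial_neg_of_boxKernel [Nonempty ι] {A : Matrix m ι ℤ} (hA : A.mulVec 1 = 0)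
    {p : ℕ} (hp : 0 < p) (P : ℕ → Polynomial ℚ)
    (hP : ∀ n : ℕ, 0 < n → ((boxKernel A 1 n).ncard : ℚ) = (P (n % p)).eval (n : ℚ)) (n : ℤ) :
    (P (((-n) % (p : ℤ)).toNat)).eval ((-n : ℤ) : ℚ) =
      (-1 : ℚ) ^ finrank ℚ (LinearMap.ker (A.map (Int.cast : ℤ → ℚ)).mulVecLin) *
        (P ((n % (p : ℤ)).toNat)).eval ((n : ℤ) : ℚ) := by
  set d := finrank ℚ (LinearMap.ker (A.map (Int.cast : ℤ → ℚ)).mulVecLin)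
  set Q : ℤ → ℚ := fun n => (P (n % (p : ℤ)).toNat).eval (n : ℚ) with hQ
  have hQpos : ∀ n : ℤ, 0 < n → Q n = (boxKernel A 1 n).ncard := by
    intro n hn
    lift n to ℕ using hn.le
    rw [hP n (by exact_mod_cast hn), hQ]
    norm_cast
  have hcount : DiffAnnihilated {a : ℤ | 0 < a} fun n => ((boxKernel A 1 n).ncard : ℚ) +
      (-1) ^ d * ((boxKernel A (n + 1) 0).ncard : ℚ) := by
    simpa only [add_sub_cancel_right] using
      (diffAnnihilated_ncard_boxKernel hA).comp_add_right 1
  have hzero := ((diffAnnihilated_quasipolynomial hp P).add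
    (hcount.map (-AddMonoidHom.id ℚ))).eq_zero (fun _ h => h) fun n hn => by
      simp [boxKernel_eq_empty A (show (0 : ℤ) < n + 1 by omega), ← hQpos n hn, hQ]
  have hQnonpos : ∀ n : ℤ, n ≤ 0 → Q n = (-1) ^ d * (boxKernel A 1 (-n)).ncard := by
    intro n hn
    have h1 := congrFun hzero n
    have h2 := ncard_boxKernel_add hA 1 (-n) n
    rw [neg_add_cancel, add_comm 1 n] at h2
    simp only [Pi.add_apply, AddMonoidHom.neg_apply, AddMonoidHom.id_apply, Pi.zero_apply,
      boxKernel_eq_empty A (show n < 1 by omega), Set.ncard_empty, h2] at h1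
    simp only [hQ]
    push_cast at h1
    linarith
  have hsq : ((-1 : ℚ) ^ d) * (-1) ^ d = 1 := by
    rw [← mul_pow]
    simp
  change Q (-n) = (-1) ^ d * Q n
  rcases lt_trichotomy n 0 with h | rfl | h
  · rw [hQnonpos n h.le, hQpos (-n) (by omega), ← mul_assoc, hsq, one_mul]
  · simp [hQnonpos 0 le_rfl, boxKernel_eq_empty A (show (0 : ℤ) < 1 by omega)]
  · rw [hQnonpos (-n) (by omega), hQpos n h, neg_neg]

end Ehrhart

section Rank

open Module

variable {m n : Type*} [Fintype m] [Fintype n] (K L : Type*) [Field K] [Field L] [Algebra K L]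

theorem rank_map_algebraMap (A : Matrix m n K) : (A.map (algebraMap K L)).rank = A.rank := by
  obtain ⟨κ, a, ha, hspan, hind⟩ := exists_linearIndependent' K A.row
  have : Finite κ := Finite.of_injective a ha
  have := Fintype.ofFinite κ
  have hrow : ∀ i, (A.map (algebraMap K L)).row i = algebraMap K L ∘ A.row i := fun i => rfl
  have hindL : LinearIndependent L ((A.map (algebraMap K L)).row ∘ a) :=
    linearIndependent_algebraMap_comp_iff.2 hind
  have hspanL : Submodule.span L (Set.range ((A.map (algebraMap K L)).row ∘ a)) =
      Submodule.span L (Set.range (A.map (algebraMap K L)).row) := by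
    refine le_antisymm (Submodule.span_mono (Set.range_comp_subset_range _ _)) ?_
    rw [Submodule.span_le]
    rintro _ ⟨i, rfl⟩
    have hi : A.row i ∈ Submodule.span K (Set.range (A.row ∘ a)) :=
      hspan ▸ Submodule.subset_span ⟨i, rfl⟩
    obtain ⟨c, hc⟩ := (Submodule.mem_span_range_iff_exists_fun K).1 hi
    refine (Submodule.mem_span_range_iff_exists_fun L).2 ⟨fun k => algebraMap K L (c k), ?_⟩
    rw [hrow, ← hc]
    ext l
    simp only [Finset.sum_apply, Pi.smul_apply, Function.comp_apply, smul_eq_mul, map_sum, map_mul]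
    rfl
  rw [Matrix.rank_eq_finrank_span_row, Matrix.rank_eq_finrank_span_row, ← hspanL, ← hspan,
    finrank_span_eq_card hindL, finrank_span_eq_card hind]

theorem finrank_ker_map_algebraMap (A : Matrix m n K) :
    finrank L (LinearMap.ker (A.map (algebraMap K L)).mulVecLin) =
      finrank K (LinearMap.ker A.mulVecLin) := by
  have h1 := LinearMap.finrank_range_add_finrank_ker A.mulVecLin
  have h2 := LinearMap.finrank_range_add_finrank_ker (A.map (algebraMap K L)).mulVecLin
  have h3 := rank_map_algebraMap K L A
  rw [finrank_fintype_fun_eq_card] at h1 h2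
  unfold Matrix.rank at h3
  omega

end Rank

section Attack

variable {q : ℕ} (R : Type*) [CommRing R]

/-- Regard `q` points of the plane as a vector with `2q` coordinates. -/
def planeEquiv (q : ℕ) : (Fin q → R × R) ≃ₗ[R] (Fin q ⊕ Fin q → R) where
  toFun z := Sum.elim (fun i => (z i).1) (fun i => (z i).2)
  invFun y i := (y (.inl i), y (.inr i))
  map_add' _ _ := by ext (i | i) <;> rfl
  map_smul' _ _ := by ext (i | i) <;> rfl
  left_inv _ := rfl
  right_inv _ := by ext (i | i) <;> rfl

@[simp]
theorem planeEquiv_inl (z : Fin q → R × R) (i : Fin q) : planeEquiv R q z (.inl i) = (z i).1 :=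
  rfl

@[simp]
theorem planeEquiv_inr (z : Fin q → R × R) (i : Fin q) : planeEquiv R q z (.inr i) = (z i).2 :=
  rfl

/-- The matrix of the attack equations `d (x_j - x_i) = c (y_j - y_i)`. -/
def attackMatrix (S : Finset (Fin q × Fin q × ℤ × ℤ)) : Matrix S (Fin q ⊕ Fin q) R :=
  Matrix.of fun t => (t.1.2.2.2 : R) • (Pi.single (.inl t.1.2.1) 1 - Pi.single (.inl t.1.1) 1) -
    (t.1.2.2.1 : R) • (Pi.single (.inr t.1.2.1) 1 - Pi.single (.inr t.1.1) 1)

theorem attackMatrix_mulVec_eq_zero_iff (S : Finset (Fin q × Fin q × ℤ × ℤ))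
    (z : Fin q → R × R) : (attackMatrix R S).mulVec (planeEquiv R q z) = 0 ↔
      ∀ t ∈ S, (t.2.2.2 : R) * ((z t.2.1).1 - (z t.1).1) =
        (t.2.2.1 : R) * ((z t.2.1).2 - (z t.1).2) := by
  rw [funext_iff, Subtype.forall]
  refine forall₂_congr fun t ht => ?_
  rw [← sub_eq_zero (a := (t.2.2.2 : R) * _)]
  change ((t.2.2.2 : R) • (Pi.single (.inl t.2.1) 1 - Pi.single (.inl t.1) 1) -
    (t.2.2.1 : R) • (Pi.single (.inr t.2.1) 1 - Pi.single (.inr t.1) 1)) ⬝ᵥ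
      planeEquiv R q z = 0 ↔ _
  simp only [sub_dotProduct, smul_dotProduct, single_dotProduct, one_mul, smul_eq_mul,
    planeEquiv_inl, planeEquiv_inr]

theorem attackMatrix_map (S : Finset (Fin q × Fin q × ℤ × ℤ)) {R' : Type*} [CommRing R']
    (g : R →+* R') : (attackMatrix R S).map g = attackMatrix R' S := by
  ext t (k | k) <;> simp [attackMatrix, Pi.single_apply, apply_ite g]

end Attack

/-- Theorem 4.1 (Parity Theorem).  Points of `ℝ^{2q}` are recorded as functions
`Fin q → ℝ × ℝ` giving the positions of `q` pieces; `U` is the intersection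
subspace of the attack equations indexed by `S`; `f n` counts the integer points
of `U` with all coordinates in `{1,…,n}`.  Any quasipolynomial representing `f`
is an odd function of `n` if `dim U` is odd and an even function if `dim U` is
even. -/
theorem stmt_7 (q : ℕ) (hq : 1 ≤ q)
    (S : Finset (Fin q × Fin q × ℤ × ℤ))
    (hS : ∀ t ∈ S, t.1 < t.2.1 ∧ t.2.2 ≠ (0, 0))
    (U : Submodule ℝ (Fin q → ℝ × ℝ))
    (hU : ∀ z : Fin q → ℝ × ℝ, z ∈ U ↔
      ∀ t ∈ S, (t.2.2.2 : ℝ) * ((z t.2.1).1 - (z t.1).1) =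
        (t.2.2.1 : ℝ) * ((z t.2.1).2 - (z t.1).2))
    (f : ℕ → ℕ)
    (hf : ∀ n : ℕ, f n = Set.ncard {z : Fin q → ℤ × ℤ |
      (∀ i, (z i).1 ∈ Set.Icc (1 : ℤ) (n : ℤ) ∧ (z i).2 ∈ Set.Icc (1 : ℤ) (n : ℤ)) ∧
      (fun i => (((z i).1 : ℝ), ((z i).2 : ℝ))) ∈ U})
    (p : ℕ) (hp : 0 < p) (P : ℕ → Polynomial ℚ)
    (hP : ∀ n : ℕ, 0 < n → (f n : ℚ) = (P (n % p)).eval (n : ℚ)) :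
    ∀ n : ℤ, (P (((-n) % (p : ℤ)).toNat)).eval ((-n : ℤ) : ℚ) =
      (-1 : ℚ) ^ (Module.finrank ℝ U) * (P ((n % (p : ℤ)).toNat)).eval ((n : ℤ) : ℚ) := by
  have : NeZero q := ⟨by omega⟩
  have hdim : Module.finrank ℝ U =
      Module.finrank ℚ (LinearMap.ker ((attackMatrix ℤ S).map (Int.cast : ℤ → ℚ)).mulVecLin) := by
    have hUker : U = (LinearMap.ker (attackMatrix ℝ S).mulVecLin).map
        ((planeEquiv ℝ q).symm : (Fin q ⊕ Fin q → ℝ) →ₗ[ℝ] (Fin q → ℝ × ℝ)) := by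
      ext z
      rw [hU, Submodule.mem_map_equiv, LinearEquiv.symm_symm, LinearMap.mem_ker,
        Matrix.mulVecLin_apply, attackMatrix_mulVec_eq_zero_iff]
    have hmap : (attackMatrix ℤ S).map (Int.cast : ℤ → ℚ) = attackMatrix ℚ S :=
      attackMatrix_map ℤ S (Int.castRingHom ℚ)
    rw [hUker, LinearEquiv.finrank_map_eq, hmap, ← finrank_ker_map_algebraMap ℚ ℝ,
      attackMatrix_map]
  have hcount : ∀ n : ℕ, f n = (boxKernel (attackMatrix ℤ S) 1 n).ncard := by
    intro n
    rw [hf, ← Set.ncard_preimage_of_injective_subset_range (planeEquiv ℤ q).injective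
      (by simp [(planeEquiv ℤ q).surjective.range_eq])]
    congr 1
    ext z
    refine and_congr ?_ ?_
    · simp only [Sum.forall, planeEquiv_inl, planeEquiv_inr, forall_and]
    · rw [hU, attackMatrix_mulVec_eq_zero_iff]
      refine forall₂_congr fun t _ => ?_
      simp only [Int.cast_id]
      norm_cast
  have hone : (attackMatrix ℤ S).mulVec 1 = 0 := by
    have : (1 : Fin q ⊕ Fin q → ℤ) = planeEquiv ℤ q fun _ => (1, 1) := by
      ext (i | i) <;> rfl
    rw [this, attackMatrix_mulVec_eq_zero_iff]
    simp
  rw [hdim]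
  exact quasipolynomial_neg_of_boxKernel hone hp P fun n hn => hcount n ▸ hP n hn
end

section
/- Let q ≥ 1 and let S be a finite set of triples (i,j,(c,d)) with 1 ≤ i < j ≤ q and (c,d) a nonzero integer vector. Let U ⊆ ℝ^{2q} be the linear subspace of tuples (x₁,y₁,…,x_q,y_q) satisfying d(x_j − x_i) = c(y_j − y_i) for every (i,j,(c,d)) ∈ S, and let f(n) = #{ z ∈ ℤ^{2q} : every coordinate of z lies in {1,…,n} and z ∈ U }. If p is a positive integer and p₀,…,p_{p−1} are polynomials with rational coefficients such that f(n) = p_{n mod p}(n) for every positive integer n, then for every r ∈ {0,…,p−1} the coefficient of X^{dim U − 1} in p_r is zero, where dim U is the dimension of U as a real vector space. -/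
open Asymptotics Filter

section LatticeBox

variable {J L : Type*} [AddCommGroup L] (φ : J → L →ₗ[ℤ] ℤ)

/-- The points of `L` whose `j`-th coordinate lies in the integer interval `(s j, s j + n]`
for every `j ∈ I`. -/
def latticeBox (I : Set J) (s : J → ℤ) (n : ℕ) : Set L :=
  {v | ∀ j ∈ I, φ j v ∈ Set.Ioc (s j) (s j + n)}

variable {φ}

lemma injective_of_forall_eq_zero (hsep : ∀ v, (∀ j, φ j v = 0) → v = 0) :
    Function.Injective (fun v j => φ j v) := by
  intro v w h
  refine sub_eq_zero.1 (hsep _ fun j => ?_)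
  rw [map_sub, sub_eq_zero]
  exact congrFun h j

lemma finite_of_bounded_coordinates [Finite J] (hsep : ∀ v, (∀ j, φ j v = 0) → v = 0)
    {R : Set L} (h : ∀ j, ∃ a b : ℤ, ∀ v ∈ R, φ j v ∈ Set.Icc a b) : R.Finite := by
  choose a b hab using h
  have hfin : (Set.univ.pi fun j => Set.Icc (a j) (b j)).Finite :=
    Set.Finite.pi fun j => Set.finite_Icc _ _
  refine (hfin.preimage (injective_of_forall_eq_zero hsep).injOn).subset fun v hv => ?_
  exact fun j _ => hab j v hv

lemma finite_latticeBox [Finite J] (hsep : ∀ v, (∀ j, φ j v = 0) → v = 0) (s : J → ℤ) (n : ℕ) :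
    (latticeBox φ Set.univ s n).Finite :=
  finite_of_bounded_coordinates hsep fun j =>
    ⟨s j, s j + n, fun _ hv => Set.Ioc_subset_Icc_self (hv j trivial)⟩

open Classical in
/-- Moving the `j`-th side of a box by one unit adds one facet and removes the opposite one. -/
lemma ncard_latticeBox_update {I : Set J} {j : J} (hj : j ∈ I) (R : Set L) (s : J → ℤ) (n : ℕ)
    (hfin : ∀ a b : ℤ, (R ∩ latticeBox φ (I \ {j}) s n ∩ {v | φ j v ∈ Set.Icc a b}).Finite) :
    (R ∩ latticeBox φ I (Function.update s j (s j + 1)) n).ncard +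
        (R ∩ latticeBox φ (I \ {j}) s n ∩ {v | φ j v = s j + 1}).ncard =
      (R ∩ latticeBox φ I s n).ncard +
        (R ∩ latticeBox φ (I \ {j}) s n ∩ {v | φ j v = s j + n + 1}).ncard := by
  have split : ∀ t : J → ℤ, (∀ i ≠ j, t i = s i) → R ∩ latticeBox φ I t n =
      R ∩ latticeBox φ (I \ {j}) s n ∩ {v | φ j v ∈ Set.Ioc (t j) (t j + n)} := by
    intro t ht
    ext v
    constructor
    · rintro ⟨hR, hv⟩
      refine ⟨⟨hR, fun i hi => ?_⟩, hv j hj⟩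
      rw [← ht i hi.2]
      exact hv i hi.1
    · rintro ⟨⟨hR, hv⟩, hvj⟩
      refine ⟨hR, fun i hi => ?_⟩
      by_cases h : i = j
      · subst h; exact hvj
      · rw [ht i h]; exact hv i ⟨hi, h⟩
  rw [split s fun _ _ => rfl, split _ fun i hi => Function.update_of_ne hi _ _]
  set M := R ∩ latticeBox φ (I \ {j}) s n
  have hM : ∀ (p : ℤ → Prop), (∀ x, p x → s j ≤ x ∧ x ≤ s j + n + 1) →
      (M ∩ {v | p (φ j v)}).Finite := fun p hp =>
    (hfin (s j) (s j + n + 1)).subset fun v hv => ⟨hv.1, hp _ hv.2⟩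
  have disj : ∀ p p' : ℤ → Prop, (∀ x, p x → ¬ p' x) →
      Disjoint (M ∩ {v | p (φ j v)}) (M ∩ {v | p' (φ j v)}) := fun p p' h =>
    Set.disjoint_left.2 fun v hv hw => h _ hv.2 hw.2
  rw [Function.update_self,
    ← Set.ncard_union_eq (disj (· ∈ Set.Ioc (s j + 1) (s j + 1 + n)) (· = s j + 1) ?_)
      (hM (· ∈ Set.Ioc (s j + 1) (s j + 1 + n)) ?_) (hM (· = s j + 1) ?_),
    ← Set.ncard_union_eq (disj (· ∈ Set.Ioc (s j) (s j + n)) (· = s j + n + 1) ?_)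
      (hM (· ∈ Set.Ioc (s j) (s j + n)) ?_) (hM (· = s j + n + 1) ?_)]
  · congr 1
    ext v
    simp only [Set.mem_union, Set.mem_inter_iff, Set.mem_ofPred_eq, Set.mem_Ioc,
      ← and_or_left]
    refine and_congr_right fun _ => ?_
    omega
  all_goals
    intro x
    try simp only [Set.mem_Ioc]
    omega

lemma rel_of_rel_update {r : (J → ℤ) → (J → ℤ) → Prop} [Finite J] [DecidableEq J]
    (hr : Equivalence r) (h : ∀ s j, r (Function.update s j (s j + 1)) s) (s t : J → ℤ) :
    r s t := by
  have single : ∀ s j c, r (Function.update s j c) s := by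
    intro s j c
    induction c using Int.inductionOn' (b := s j) with
    | zero => simpa using hr.refl s
    | succ c _ ih => simpa using hr.trans (h (Function.update s j c) j) ih
    | pred c _ ih => simpa using hr.trans (hr.symm (h (Function.update s j (c - 1)) j))
                      (by simpa using ih)
  have := Fintype.ofFinite J
  have main : ∀ (F : Finset J) (s : J → ℤ), (∀ j ∉ F, s j = t j) → r s t := by
    intro F
    induction F using Finset.induction_on with
    | empty =>
      intro s hs
      rw [funext fun j => hs j (by simp)]
      exact hr.refl t
    | insert a F _ ih =>
      intro s hs
      refine hr.trans (hr.symm (single s a (t a))) (ih _ fun j hj => ?_)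
      by_cases hja : j = a
      · subst hja; simp
      · rw [Function.update_of_ne hja, hs j (by simp [hja, hj])]
  exact main Finset.univ s (by simp)

lemma ncard_latticeBox_facet_reflection {e : L} (he : ∀ j, φ j e = 1) (k : J) (s : J → ℤ) (n : ℕ) :
    ({v | φ k v = s k + n + 1} ∩ latticeBox φ {k}ᶜ s n).ncard =
      ({v | φ k v = s k + 1} ∩ latticeBox φ {k}ᶜ (fun j => 2 * s k + 1 - s j) n).ncard := by
  rw [← Set.ncard_image_of_injective _
    (Equiv.subLeft ((2 * s k + n + 2) • e)).injective, Equiv.image_eq_preimage_symm]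
  congr 1
  ext v
  simp only [latticeBox, Set.mem_preimage, Set.mem_inter_iff, Set.mem_ofPred_eq, Set.mem_Ioc,
    Equiv.subLeft_symm_apply, map_add, map_neg, map_smul, he, smul_eq_mul, mul_one]
  refine and_congr (by omega) (forall₂_congr fun j _ => by omega)


section Rank

variable [Module.Free ℤ L] [Module.Finite ℤ L]

/-- Two distinct coordinates extend to a separating family of at most `finrank ℤ L` coordinates. -/
lemma exists_separating_finset [Finite J] (hφ : Function.Injective φ)
    (hsep : ∀ v, (∀ j, φ j v = 0) → v = 0) {e : L} (he : ∀ j, φ j e = 1) {k j : J} (hkj : j ≠ k) :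
    ∃ T : Finset J, k ∉ T ∧ j ∉ T ∧ T.card + 2 ≤ Module.finrank ℤ L ∧
      ∀ v w, φ k v = φ k w → φ j v = φ j w → (∀ i ∈ T, φ i v = φ i w) → v = w := by
  classical
  have := Fintype.ofFinite J
  let ψ : J → L →ₗ[ℤ] ℚ := fun i => (Algebra.linearMap ℤ ℚ).comp (φ i)
  have hψ : ∀ i v, ψ i v = (φ i v : ℚ) := fun i v => by simp [ψ]
  have hindep : LinearIndepOn ℚ ψ ({k, j} : Set J) := by
    rw [LinearIndepOn.pair_iff ψ hkj.symm]
    intro a b hab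
    have hab' : ∀ v, a * φ k v + b * φ j v = 0 := fun v => by
      simpa [hψ] using LinearMap.congr_fun hab v
    obtain ⟨v, hv⟩ : ∃ v, φ k v ≠ φ j v := by
      by_contra! h
      exact hkj (hφ (LinearMap.ext h)).symm
    have h1 : a + b = 0 := by simpa [he] using hab' e
    have h2 : a * ((φ k v : ℚ) - φ j v) = 0 := by linear_combination hab' v - φ j v * h1
    have h3 : (φ k v : ℚ) - φ j v ≠ 0 := sub_ne_zero.2 (by exact_mod_cast hv)
    have h4 : a = 0 := (mul_eq_zero.1 h2).resolve_right h3
    exact ⟨h4, by linarith⟩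
  obtain ⟨B, -, hB, hspan, hBi⟩ := exists_linearIndepOn_extension hindep (Set.subset_univ _)
  have hk : k ∈ B.toFinset := by simpa using hB (by simp)
  have hj : j ∈ B.toFinset := by simpa using hB (by simp)
  refine ⟨(B.toFinset.erase k).erase j, by simp, by simp, ?_, fun v w h1 h2 h3 => ?_⟩
  · have hcard : B.toFinset.card ≤ Module.finrank ℤ L := by
      have h := hBi.linearIndependent.fintype_card_le_finrank
      rwa [Module.finrank_linearMap_self, ← Set.toFinset_card] at h
    have hj' : j ∈ B.toFinset.erase k := Finset.mem_erase.2 ⟨hkj, hj⟩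
    have h1 := Finset.card_erase_add_one hj'
    have h2 := Finset.card_erase_add_one hk
    omega
  · rw [← sub_eq_zero]
    refine hsep _ fun i => ?_
    have hle : ∀ x ∈ Submodule.span ℚ (ψ '' B), x (v - w) = 0 := by
      intro x hx
      induction hx using Submodule.span_induction with
      | mem x hx =>
        obtain ⟨l, hl, rfl⟩ := hx
        rw [hψ, map_sub, Int.cast_eq_zero, sub_eq_zero]
        by_cases hlk : l = k
        · rw [hlk, h1]
        by_cases hlj : l = j
        · rw [hlj, h2]
        · exact h3 l (by simp [hlk, hlj, hl])
      | zero => simp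
      | add x y _ _ hx hy => simp [hx, hy]
      | smul c x _ hx => simp [hx]
    have := hle _ (hspan ⟨i, trivial, rfl⟩)
    rwa [hψ, Int.cast_eq_zero] at this

lemma two_le_finrank [Finite J] (hφ : Function.Injective φ)
    (hsep : ∀ v, (∀ j, φ j v = 0) → v = 0) {e : L} (he : ∀ j, φ j e = 1) {k j : J} (hkj : j ≠ k) :
    2 ≤ Module.finrank ℤ L := by
  obtain ⟨T, -, -, hT, -⟩ := exists_separating_finset hφ hsep he hkj
  omega

lemma ncard_codim_two_le [Finite J] (hφ : Function.Injective φ)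
    (hsep : ∀ v, (∀ j, φ j v = 0) → v = 0) {e : L} (he : ∀ j, φ j e = 1) {k j : J} (hkj : j ≠ k)
    (a b : ℤ) (s : J → ℤ) {n : ℕ} (hn : 1 ≤ n) :
    ({v | φ k v = a} ∩ latticeBox φ ({k}ᶜ \ {j}) s n ∩ {v | φ j v = b}).ncard ≤
      n ^ (Module.finrank ℤ L - 2) := by
  classical
  obtain ⟨T, hkT, hjT, hT, hinj⟩ := exists_separating_finset hφ hsep he hkj
  calc _ ≤ ((Fintype.piFinset fun i : T => Finset.Ioc (s i.1) (s i.1 + n) : Finset (T → ℤ)) :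
        Set (T → ℤ)).ncard := by
        refine Set.ncard_le_ncard_of_injOn (fun v i => φ i v) ?_ ?_ (Finset.finite_toSet _)
        · rintro v ⟨⟨-, hv⟩, -⟩
          simp only [Finset.mem_coe, Fintype.mem_piFinset, Finset.mem_Ioc]
          exact fun i => hv i ⟨fun h => hkT (h ▸ i.2), fun h => hjT (h ▸ i.2)⟩
        · rintro v ⟨⟨hv, -⟩, hv'⟩ w ⟨⟨hw, -⟩, hw'⟩ h
          exact hinj v w (hv.trans hw.symm) (hv'.trans hw'.symm) fun i hi => congrFun h ⟨i, hi⟩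
    _ = n ^ T.card := by
        rw [Set.ncard_coe_finset, Fintype.card_piFinset]
        simp
    _ ≤ _ := Nat.pow_le_pow_right hn (by omega)

/-- Translating the sides of a box changes the number of points on a facet only in
codimension two. -/
lemma isBigO_ncard_facet_sub [Finite J] (hφ : Function.Injective φ)
    (hsep : ∀ v, (∀ j, φ j v = 0) → v = 0) {e : L} (he : ∀ j, φ j e = 1) (k : J) (c : ℤ)
    (s t : J → ℤ) :
    (fun n : ℕ => (({v | φ k v = c} ∩ latticeBox φ {k}ᶜ s n).ncard : ℝ) -
        ({v | φ k v = c} ∩ latticeBox φ {k}ᶜ t n).ncard) =O[atTop]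
      fun n : ℕ => (n : ℝ) ^ (Module.finrank ℤ L - 2) := by
  classical
  refine rel_of_rel_update (r := fun s t =>
    (fun n : ℕ => (({v | φ k v = c} ∩ latticeBox φ {k}ᶜ s n).ncard : ℝ) -
        ({v | φ k v = c} ∩ latticeBox φ {k}ᶜ t n).ncard) =O[atTop]
      fun n : ℕ => (n : ℝ) ^ (Module.finrank ℤ L - 2)) ⟨?_, ?_, ?_⟩ ?_ s t
  · intro s; simpa using isBigO_zero _ _
  · intro s t h; simpa using h.neg_left
  · intro s t u h h'; simpa using h.add h'
  · intro s j
    by_cases hjk : j = k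
    · subst hjk
      have : ∀ n, latticeBox φ {j}ᶜ (Function.update s j (s j + 1)) n =
          latticeBox φ {j}ᶜ s n := fun n => by
        refine Set.ext fun v => forall₂_congr fun i hi => ?_
        rw [Function.update_of_ne hi]
      simpa [this] using isBigO_zero _ _
    · have key := fun n => ncard_latticeBox_update (φ := φ) (I := {k}ᶜ) (j := j) hjk
        {v | φ k v = c} s n fun a b => finite_of_bounded_coordinates hsep fun i => by
          by_cases hik : i = k
          · exact ⟨c, c, fun v hv => by rw [hik, hv.1.1]; simp⟩
          by_cases hij : i = j
          · exact ⟨a, b, fun v hv => hij ▸ hv.2⟩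
          · exact ⟨s i, s i + n, fun v hv => Set.Ioc_subset_Icc_self (hv.1.2 i ⟨hik, hij⟩)⟩
      refine IsBigO.of_bound 1 ?_
      filter_upwards [eventually_ge_atTop 1] with n hn
      have h1 := ncard_codim_two_le hφ hsep he hjk c (s j + 1) s hn
      have h2 := ncard_codim_two_le hφ hsep he hjk c (s j + n + 1) s hn
      have h3 := congrArg (Nat.cast (R := ℝ)) (key n)
      rw [← Nat.cast_le (α := ℝ), Nat.cast_pow] at h1 h2
      rw [Nat.cast_add, Nat.cast_add] at h3
      have h4 : (0 : ℝ) ≤ (n : ℝ) ^ (Module.finrank ℤ L - 2) := by positivity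
      rw [one_mul, Real.norm_of_nonneg h4, Real.norm_eq_abs, abs_le]
      constructor <;> linarith [Nat.cast_nonneg (α := ℝ)
        ({v | φ k v = c} ∩ latticeBox φ ({k}ᶜ \ {j}) s n ∩ {v | φ j v = s j + 1}).ncard,
        Nat.cast_nonneg (α := ℝ)
        ({v | φ k v = c} ∩ latticeBox φ ({k}ᶜ \ {j}) s n ∩ {v | φ j v = s j + n + 1}).ncard]

/-- The number of lattice points of a box does not depend on small translations of its sides,
up to an error of codimension two. -/
lemma isBigO_ncard_latticeBox_sub [Finite J] (hφ : Function.Injective φ)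
    (hsep : ∀ v, (∀ j, φ j v = 0) → v = 0) {e : L} (he : ∀ j, φ j e = 1) (s t : J → ℤ) :
    (fun n : ℕ => ((latticeBox φ Set.univ s n).ncard : ℝ) -
        (latticeBox φ Set.univ t n).ncard) =O[atTop]
      fun n : ℕ => (n : ℝ) ^ (Module.finrank ℤ L - 2) := by
  classical
  refine rel_of_rel_update (r := fun s t =>
    (fun n : ℕ => ((latticeBox φ Set.univ s n).ncard : ℝ) -
        (latticeBox φ Set.univ t n).ncard) =O[atTop]
      fun n : ℕ => (n : ℝ) ^ (Module.finrank ℤ L - 2)) ⟨?_, ?_, ?_⟩ ?_ s t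
  · intro s; simpa using isBigO_zero _ _
  · intro s t h; simpa using h.neg_left
  · intro s t u h h'; simpa using h.add h'
  · intro s k
    refine (isBigO_ncard_facet_sub hφ hsep he k (s k + 1)
      (fun j => 2 * s k + 1 - s j) s).congr_left fun n => ?_
    have key := ncard_latticeBox_update (φ := φ) (Set.mem_univ k) Set.univ s n fun a b =>
      finite_of_bounded_coordinates hsep fun i => by
        by_cases hik : i = k
        · exact ⟨a, b, fun v hv => hik ▸ hv.2⟩
        · exact ⟨s i, s i + n, fun v hv => Set.Ioc_subset_Icc_self (hv.1.2 i ⟨trivial, hik⟩)⟩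
    rw [← ncard_latticeBox_facet_reflection he]
    simp only [Set.univ_inter, ← Set.compl_eq_univ_sdiff] at key
    rw [Set.inter_comm, Set.inter_comm {v | φ k v = s k + 1}]
    have key' := congrArg (Nat.cast (R := ℝ)) key
    rw [Nat.cast_add, Nat.cast_add] at key'
    linarith

/-- Division with remainder in a lattice, with respect to a basis. -/
lemma exists_bijective_smul_add (m : ℕ) [NeZero m] :
    ∃ u : (Fin (Module.finrank ℤ L) → Fin m) → L,
      Function.Bijective (fun x : (Fin (Module.finrank ℤ L) → Fin m) × L =>
        (m : ℤ) • x.2 + u x.1) := by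
  let b := Module.finBasis ℤ L
  let E : L ≃ (Fin (Module.finrank ℤ L) → Fin m) × L :=
    b.equivFun.toEquiv.trans <| (Equiv.piCongrRight fun _ => Int.divModEquiv m).trans <|
      (Equiv.arrowProdEquivProdArrow _ _ _).trans <|
        (Equiv.prodComm _ _).trans ((Equiv.refl _).prodCongr b.equivFun.symm.toEquiv)
  refine ⟨fun c => b.equivFun.symm fun i => ((c i : ℕ) : ℤ), ?_⟩
  convert E.symm.bijective using 1
  ext1 x
  apply b.equivFun.injective
  rw [map_add, map_smul, LinearEquiv.apply_symm_apply]
  simp only [E, Equiv.symm_trans_apply, LinearEquiv.coe_toEquiv_symm]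
  ext i
  simp [Equiv.arrowProdEquivProdArrow, mul_comm, Equiv.piCongrRight,
    -Module.Basis.equivFun_apply, -Module.Basis.equivFun_symm_apply]

/-- Splitting the points of a dilated box according to their residues. -/
lemma exists_ncard_latticeBox_mul_eq_sum [Finite J] (hsep : ∀ v, (∀ j, φ j v = 0) → v = 0)
    (m : ℕ) [NeZero m] :
    ∃ s : (Fin (Module.finrank ℤ L) → Fin m) → J → ℤ, ∀ n : ℕ,
      (latticeBox φ Set.univ 0 (m * n)).ncard =
        ∑ c, (latticeBox φ Set.univ (s c) n).ncard := by
  obtain ⟨u, hu⟩ := exists_bijective_smul_add (L := L) m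
  refine ⟨fun c j => -(φ j (u c)) / m, fun n => ?_⟩
  have hm : (0 : ℤ) < m := by exact_mod_cast Nat.pos_of_ne_zero (NeZero.ne m)
  have hmem : ∀ c v, (m : ℤ) • v + u c ∈ latticeBox φ Set.univ 0 (m * n) ↔
      v ∈ latticeBox φ Set.univ (fun j => -(φ j (u c)) / m) n := by
    intro c v
    refine forall₂_congr fun j _ => ?_
    simp only [Set.mem_Ioc, map_add, map_smul, smul_eq_mul, Pi.zero_apply, Nat.cast_mul]
    rw [← sub_le_iff_le_add (a := φ j v), Int.ediv_lt_iff_lt_mul hm, Int.le_ediv_iff_mul_le hm]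
    refine and_congr ?_ ?_ <;> constructor <;> intro h <;> linarith
  have : ∀ c, Finite (latticeBox φ Set.univ (fun j => -(φ j (u c)) / m) n) := fun c =>
    (finite_latticeBox hsep _ n).to_subtype
  simp only [← Nat.card_coe_set_eq]
  rw [← Nat.card_sigma]
  refine Nat.card_congr (Equiv.symm (Equiv.ofBijective
    (fun x => ⟨(m : ℤ) • x.2.1 + u x.1, (hmem _ _).2 x.2.2⟩) ⟨?_, ?_⟩))
  · rintro ⟨c, v, hv⟩ ⟨c', v', hv'⟩ h
    have := hu.1 (a₁ := (c, v)) (a₂ := (c', v')) (Subtype.ext_iff.1 h)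
    obtain ⟨rfl, rfl⟩ := Prod.ext_iff.1 this
    rfl
  · rintro ⟨w, hw⟩
    obtain ⟨⟨c, v⟩, rfl⟩ := hu.2 w
    exact ⟨⟨c, v, (hmem _ _).1 hw⟩, rfl⟩

/-- The counting function of a box is homogeneous of degree `finrank ℤ L` up to an error of
codimension two. -/
theorem isBigO_ncard_latticeBox_mul_sub [Finite J] (hφ : Function.Injective φ)
    (hsep : ∀ v, (∀ j, φ j v = 0) → v = 0) {e : L} (he : ∀ j, φ j e = 1) (m : ℕ) [NeZero m] :
    (fun n : ℕ => ((latticeBox φ Set.univ 0 (m * n)).ncard : ℝ) -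
        (m : ℝ) ^ Module.finrank ℤ L * (latticeBox φ Set.univ 0 n).ncard) =O[atTop]
      fun n : ℕ => (n : ℝ) ^ (Module.finrank ℤ L - 2) := by
  obtain ⟨s, hs⟩ := exists_ncard_latticeBox_mul_eq_sum hsep m
  refine (IsBigO.sum (s := Finset.univ) fun c _ =>
    isBigO_ncard_latticeBox_sub hφ hsep he (s c) 0).congr_left fun n => ?_
  rw [hs]
  simp

end Rank

end LatticeBox

/-- A polynomial of order `x ^ d` along a sequence tending to infinity has degree at most `d`. -/
lemma Polynomial.natDegree_le_of_isBigO {Q : Polynomial ℝ} {x : ℕ → ℝ} (hx : Tendsto x atTop atTop)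
    {d : ℕ} (h : (fun t => Q.eval (x t)) =O[atTop] fun t => x t ^ d) : Q.natDegree ≤ d := by
  by_contra! hd
  have hQ : Q.leadingCoeff ≠ 0 := fun h0 => by
    rw [Polynomial.leadingCoeff_eq_zero.1 h0, Polynomial.natDegree_zero] at hd
    omega
  have h1 : (fun t => x t ^ Q.natDegree) =O[atTop] fun t => Q.eval (x t) := by
    have := (Q.isEquivalent_atTop_lead.symm.isBigO).comp_tendsto hx
    exact (isBigO_const_mul_left_iff hQ).1 this
  have h2 : (fun t => x t ^ d) =o[atTop] fun t => x t ^ Q.natDegree :=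
    (isLittleO_pow_pow_atTop_of_lt hd).comp_tendsto hx
  have h3 := (h1.trans h).trans_isLittleO h2
  refine isLittleO_irrefl ?_ h3
  refine Eventually.frequently ?_
  filter_upwards [hx.eventually_gt_atTop 0] with t ht using (pow_pos ht _).ne'

/-- A quasipolynomial which is homogeneous of degree `D` up to an error of order `n ^ (D - 2)`
has vanishing coefficients in degree `D - 1`. -/
lemma coeff_eq_zero_of_quasipolynomial {f : ℕ → ℕ} {p D : ℕ} (hp : 0 < p) (hD : 2 ≤ D)
    {P : ℕ → Polynomial ℚ} (hP : ∀ n : ℕ, 0 < n → (f n : ℚ) = (P (n % p)).eval (n : ℚ))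
    (hf : (fun n : ℕ => (f ((p + 1) * n) : ℝ) - ((p + 1 : ℕ) : ℝ) ^ D * f n) =O[atTop]
      fun n : ℕ => (n : ℝ) ^ (D - 2)) {r : ℕ} (hr : r < p) : (P r).coeff (D - 1) = 0 := by
  set p' : Polynomial ℝ := (P r).map (algebraMap ℚ ℝ) with hp'
  let m : ℝ := ((p + 1 : ℕ) : ℝ)
  let Q : Polynomial ℝ := p'.comp (.C m * .X) - .C (m ^ D) * p'
  have hP' : ∀ n : ℕ, 0 < n → n % p = r → (f n : ℝ) = p'.eval (n : ℝ) := by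
    intro n hn hnr
    have := congrArg (algebraMap ℚ ℝ) (hP n hn)
    rw [hnr, ← Polynomial.eval_map_apply] at this
    simpa [hp'] using this
  have hseq : Tendsto (fun t : ℕ => p * t + r) atTop atTop :=
    tendsto_atTop_mono (fun t => (Nat.le_mul_of_pos_left t hp).trans (Nat.le_add_right _ _)) tendsto_id
  have hQ : Q.natDegree ≤ D - 2 := by
    refine Polynomial.natDegree_le_of_isBigO (tendsto_natCast_atTop_atTop.comp hseq)
      ((hf.comp_tendsto hseq).congr' ?_ .rfl)
    filter_upwards [eventually_ge_atTop 1] with t ht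
    have hpos : 0 < p * t + r := by positivity
    have hmod : (p * t + r) % p = r := by
      rw [Nat.mul_add_mod, Nat.mod_eq_of_lt hr]
    have hmod' : (p + 1) * (p * t + r) % p = r := by
      rw [add_mul, one_mul, Nat.mul_add_mod, hmod]
    simp only [Function.comp_apply]
    rw [hP' _ hpos hmod, hP' _ (by positivity) hmod']
    simp [Q, m]
  have hcoeff : Q.coeff (D - 1) = 0 := Polynomial.coeff_eq_zero_of_natDegree_lt (by omega)
  have hm : m ^ (D - 1) - m ^ D ≠ 0 := by
    refine sub_ne_zero.2 (ne_of_lt (pow_lt_pow_right₀ ?_ (by omega)))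
    simpa [m] using hp
  rw [Polynomial.coeff_sub, Polynomial.comp_C_mul_X_coeff, Polynomial.coeff_C_mul,
    show p'.coeff (D - 1) * m ^ (D - 1) - m ^ D * p'.coeff (D - 1) =
      (m ^ (D - 1) - m ^ D) * p'.coeff (D - 1) by ring] at hcoeff
  have := (mul_eq_zero.1 hcoeff).resolve_left hm
  rw [hp', Polynomial.coeff_map] at this
  exact (map_eq_zero _).1 this

/-- The integer points of a linear subspace cut out by integral equations have full rank. -/
lemma finrank_ker_eq_of_isBaseChange {M N M' N' : Type*} [AddCommGroup M] [AddCommGroup N]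
    [AddCommGroup M'] [Module ℝ M'] [AddCommGroup N'] [Module ℝ N'] [Module.Free ℤ M]
    [Module.Finite ℤ M] {i : M →ₗ[ℤ] M'} {j : N →ₗ[ℤ] N'}
    (hi : IsBaseChange ℝ i) (hj : IsBaseChange ℝ j) {g : M →ₗ[ℤ] N} {g' : M' →ₗ[ℝ] N'}
    (h : ∀ x, g' (i x) = j (g x)) :
    Module.finrank ℝ (LinearMap.ker g') = Module.finrank ℤ (LinearMap.ker g) := by
  let k : LinearMap.ker g →ₗ[ℤ] LinearMap.ker g' :=
    (i.comp (LinearMap.ker g).subtype).codRestrict ((LinearMap.ker g').restrictScalars ℤ)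
      fun x => by simp [h]
  have hk : IsBaseChange ℝ k := IsBaseChange.of_left_exact ℝ k i j
    (f := (LinearMap.ker g).subtype) (g := g) (f' := (LinearMap.ker g').subtype) (g' := g')
    (by ext; rfl) (by ext; simp [h]) hi hj (LinearMap.exact_subtype_ker_map g)
    (Submodule.injective_subtype _) (LinearMap.exact_subtype_ker_map g')
    (Submodule.injective_subtype _)
  rw [← hk.equiv.finrank_eq, Module.finrank_baseChange]

/-- The linear map whose kernel is the intersection of the hyperplanes `d (xⱼ - xᵢ) = c (yⱼ - yᵢ)`
for `(i, j, c, d) ∈ S`. -/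
def moveMap (R : Type*) [CommRing R] {q : ℕ} (S : Finset (Fin q × Fin q × ℤ × ℤ)) :
    (Fin q → R × R) →ₗ[R] (S → R) where
  toFun z t := (t.1.2.2.2 : R) * ((z t.1.2.1).1 - (z t.1.1).1) -
    (t.1.2.2.1 : R) * ((z t.1.2.1).2 - (z t.1.1).2)
  map_add' z w := by ext t; simp; ring
  map_smul' a z := by ext t; simp; ring

theorem stmt_8 (q : ℕ) (hq : 1 ≤ q)
    (S : Finset (Fin q × Fin q × ℤ × ℤ))
    (hS : ∀ t ∈ S, t.1 < t.2.1 ∧ t.2.2 ≠ (0, 0))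
    (U : Submodule ℝ (Fin q → ℝ × ℝ))
    (hU : ∀ z : Fin q → ℝ × ℝ, z ∈ U ↔
      ∀ t ∈ S, (t.2.2.2 : ℝ) * ((z t.2.1).1 - (z t.1).1) =
        (t.2.2.1 : ℝ) * ((z t.2.1).2 - (z t.1).2))
    (f : ℕ → ℕ)
    (hf : ∀ n : ℕ, f n = Set.ncard {z : Fin q → ℤ × ℤ |
      (∀ i, (z i).1 ∈ Set.Icc (1 : ℤ) (n : ℤ) ∧ (z i).2 ∈ Set.Icc (1 : ℤ) (n : ℤ)) ∧
      (fun i => (((z i).1 : ℝ), ((z i).2 : ℝ))) ∈ U})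
    (p : ℕ) (hp : 0 < p) (P : ℕ → Polynomial ℚ)
    (hP : ∀ n : ℕ, 0 < n → (f n : ℚ) = (P (n % p)).eval (n : ℚ)) :
    ∀ r : ℕ, r < p → (P r).coeff (Module.finrank ℝ U - 1) = 0 := by
  intro r hr
  let g := moveMap ℤ S
  let g' := moveMap ℝ S
  have hUg : U = LinearMap.ker g' := by
    ext z
    rw [hU, LinearMap.mem_ker, funext_iff, Subtype.forall]
    refine forall₂_congr fun t _ => ?_
    simp [g', moveMap, sub_eq_zero]
  let ι : (Fin q → ℤ × ℤ) →ₗ[ℤ] (Fin q → ℝ × ℝ) := .pi fun i =>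
    ((Algebra.linearMap ℤ ℝ).prodMap (Algebra.linearMap ℤ ℝ)) ∘ₗ .proj i
  let κ : (S → ℤ) →ₗ[ℤ] (S → ℝ) := .pi fun i => Algebra.linearMap ℤ ℝ ∘ₗ .proj i
  have hι : IsBaseChange ℝ ι := IsBaseChange.pi _ fun _ =>
    IsBaseChange.prodMap _ _ (IsBaseChange.linearMap ℤ ℝ) (IsBaseChange.linearMap ℤ ℝ)
  have hκ : IsBaseChange ℝ κ := IsBaseChange.pi _ fun _ => IsBaseChange.linearMap ℤ ℝ
  have hcomm : ∀ z, g' (ι z) = κ (g z) := fun z => by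
    ext t
    simp [g, g', ι, κ, moveMap]
  have hmem : ∀ z : Fin q → ℤ × ℤ,
      (fun i => (((z i).1 : ℝ), ((z i).2 : ℝ))) ∈ U ↔ z ∈ LinearMap.ker g := by
    intro z
    rw [hUg, LinearMap.mem_ker, LinearMap.mem_ker]
    change g' (ι z) = 0 ↔ _
    rw [hcomm, funext_iff, funext_iff]
    simp [κ]
  have hrank : Module.finrank ℝ U = Module.finrank ℤ (LinearMap.ker g) := by
    rw [hUg, finrank_ker_eq_of_isBaseChange hι hκ hcomm]
  let coord : Fin q ⊕ Fin q → LinearMap.ker g →ₗ[ℤ] ℤ := Sum.elim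
    (fun i => LinearMap.fst ℤ ℤ ℤ ∘ₗ .proj i ∘ₗ (LinearMap.ker g).subtype)
    (fun i => LinearMap.snd ℤ ℤ ℤ ∘ₗ .proj i ∘ₗ (LinearMap.ker g).subtype)
  let φ : Set.range coord → LinearMap.ker g →ₗ[ℤ] ℤ := Subtype.val
  have hsep : ∀ v, (∀ j, φ j v = 0) → v = 0 := by
    intro v hv
    ext i
    · exact hv ⟨coord (.inl i), ⟨_, rfl⟩⟩
    · exact hv ⟨coord (.inr i), ⟨_, rfl⟩⟩
  have hconst : ∀ a b : ℤ, (fun _ => (a, b)) ∈ LinearMap.ker g := fun a b => by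
    rw [LinearMap.mem_ker]
    ext t
    simp [g, moveMap]
  have he : ∀ j, φ j ⟨_, hconst 1 1⟩ = 1 := by
    rintro ⟨_, i | i, rfl⟩ <;> rfl
  have hfN : ∀ n, f n = (latticeBox φ Set.univ 0 n).ncard := by
    intro n
    rw [hf, ← Set.ncard_image_of_injective _ (LinearMap.ker g).injective_subtype]
    congr 1
    ext z
    simp only [Set.mem_ofPred_eq, hmem, Set.mem_image]
    constructor
    · rintro ⟨hz, hzg⟩
      refine ⟨⟨z, hzg⟩, ?_, rfl⟩
      rintro ⟨_, i | i, rfl⟩ -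
      · simpa [φ, coord, Int.lt_iff_add_one_le] using (hz i).1
      · simpa [φ, coord, Int.lt_iff_add_one_le] using (hz i).2
    · rintro ⟨w, hw, rfl⟩
      refine ⟨fun i => ⟨?_, ?_⟩, w.2⟩
      · simpa [φ, coord, Int.lt_iff_add_one_le] using hw ⟨coord (.inl i), ⟨_, rfl⟩⟩ trivial
      · simpa [φ, coord, Int.lt_iff_add_one_le] using hw ⟨coord (.inr i), ⟨_, rfl⟩⟩ trivial
  let i₀ : Fin q := ⟨0, hq⟩
  have hne : (⟨coord (.inl i₀), ⟨_, rfl⟩⟩ : Set.range coord) ≠ ⟨coord (.inr i₀), ⟨_, rfl⟩⟩ := by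
    intro h
    have := LinearMap.congr_fun (Subtype.ext_iff.1 h) ⟨_, hconst 1 0⟩
    exact one_ne_zero this
  rw [hrank]
  refine coeff_eq_zero_of_quasipolynomial hp (two_le_finrank Subtype.val_injective hsep he hne)
    hP ?_ hr
  simp only [hfN]
  exact isBigO_ncard_latticeBox_mul_sub Subtype.val_injective hsep he (p + 1)
end
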